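/- Let X be an n×n real matrix and K ⊆ ℝ^n a proper cone. Suppose S X T is row positive (nonnegative with a nonzero entry in each row) for every matrix T with T(ℝ^n_+) ⊆ K and T((ℝ^n_+)°) ⊆ K°, and every matrix S with S(K) ⊆ ℝ^n_+ and S(K°) ⊆ (ℝ^n_+)°. Then X(K°) ⊆ K°. -/

import Mathlib

open Matrix Set

/-- The nonnegative orthant in `ℝ^n`. -/
def posOrth (n : ℕ) : Set (Fin n → ℝ) := {x | ∀ i, 0 ≤ x i}

/-- A proper cone: closed, pointed convex cone with nonempty interior. -/
def IsProperCone {n : ℕ} (K : Set (Fin n → ℝ)) : Prop :=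
  (∀ x ∈ K, ∀ y ∈ K, x + y ∈ K) ∧
  (∀ (c : ℝ), 0 ≤ c → ∀ x ∈ K, c • x ∈ K) ∧
  IsClosed K ∧ K ∩ (-K) = {0} ∧ (interior K).Nonempty

/-- The dual cone of a set in `ℝ^n`. -/
def dualCone {n : ℕ} (K : Set (Fin n → ℝ)) : Set (Fin n → ℝ) :=
  {y | ∀ x ∈ K, 0 ≤ y ⬝ᵥ x}

/-- `(K₁,K₂)`-semipositivity of a matrix. -/
def SemiposCone {n m : ℕ} (K₁ : Set (Fin n → ℝ)) (K₂ : Set (Fin m → ℝ))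
    (A : Matrix (Fin m) (Fin n) ℝ) : Prop :=
  ∃ x ∈ interior K₁, A.mulVec x ∈ interior K₂

/-- Semipositivity with respect to the nonnegative orthants. -/
def Semipos {n m : ℕ} (A : Matrix (Fin m) (Fin n) ℝ) : Prop :=
  ∃ x : Fin n → ℝ, (∀ i, 0 < x i) ∧ ∀ j, 0 < A.mulVec x j

theorem mem_interior_posOrth {n : ℕ} {x : Fin n → ℝ} :
    x ∈ interior (posOrth n) ↔ ∀ i, 0 < x i := by
  have hpi : posOrth n = Set.pi univ fun _ => Ici (0 : ℝ) := by
    ext y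
    simp [posOrth, Pi.le_def]
  rw [hpi, interior_pi_set finite_univ]
  simp

namespace IsProperCone

variable {n : ℕ} {K : Set (Fin n → ℝ)}

theorem convex (hK : IsProperCone K) : Convex ℝ K := by
  intro x hx y hy a b ha hb _
  exact hK.1 _ (hK.2.1 a ha x hx) _ (hK.2.1 b hb y hy)

theorem add_mem_interior (hK : IsProperCone K) {x y : Fin n → ℝ} (hx : x ∈ K)
    (hy : y ∈ interior K) : x + y ∈ interior K := by
  refine interior_maximal ?_ ((isOpenMap_add_left x) _ isOpen_interior) (mem_image_of_mem _ hy)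
  rintro _ ⟨z, hz, rfl⟩
  exact hK.1 _ hx _ (interior_subset hz)

theorem smul_mem_interior (hK : IsProperCone K) {c : ℝ} (hc : 0 < c) {x : Fin n → ℝ}
    (hx : x ∈ interior K) : c • x ∈ interior K := by
  refine interior_maximal ?_ ((isOpenMap_smul₀ hc.ne') _ isOpen_interior) (mem_image_of_mem _ hx)
  rintro _ ⟨z, hz, rfl⟩
  exact hK.2.1 c hc.le _ (interior_subset hz)

/-- A point outside the interior of a proper cone is separated from it by a functional which is
nonnegative on the cone and positive on its interior. -/
theorem exists_dual_of_notMem_interior (hK : IsProperCone K) {p : Fin n → ℝ}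
    (hp : p ∉ interior K) :
    ∃ s : Fin n → ℝ, (∀ y ∈ K, 0 ≤ s ⬝ᵥ y) ∧ (∀ y ∈ interior K, 0 < s ⬝ᵥ y) ∧ s ⬝ᵥ p ≤ 0 := by
  obtain ⟨f, hf⟩ := geometric_hahn_banach_open_point hK.convex.interior isOpen_interior hp
  have hrep : ∀ y, (fun i => -f (Pi.single i 1)) ⬝ᵥ y = -f y := by
    intro y
    conv_rhs => rw [← Finset.univ_sum_single y, map_sum]
    rw [dotProduct, ← Finset.sum_neg_distrib]
    refine Finset.sum_congr rfl fun i _ => ?_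
    have : (Pi.single i (y i) : Fin n → ℝ) = y i • Pi.single i 1 := by
      rw [← Pi.single_smul, smul_eq_mul, mul_one]
    rw [this, map_smul, smul_eq_mul]
    ring
  obtain ⟨x, hx⟩ := hK.2.2.2.2
  have hnonpos : ∀ y ∈ K, f y ≤ 0 := by
    intro y hy
    by_contra! hpos
    have hc : 0 ≤ (f p - f x) / f y := div_nonneg (sub_nonneg.2 (hf x hx).le) hpos.le
    have := hf _ (hK.add_mem_interior (hK.2.1 _ hc y hy) hx)
    rw [map_add, map_smul, smul_eq_mul, div_mul_cancel₀ _ hpos.ne'] at this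
    linarith
  refine ⟨fun i => -f (Pi.single i 1), fun y hy => ?_, fun y hy => ?_, ?_⟩
  · rw [hrep]
    linarith [hnonpos y hy]
  · rw [hrep]
    have hcont : Filter.Tendsto (fun t : ℝ => y + t • (p - x)) (nhdsWithin 0 (Ioi 0))
        (nhds y) := by
      have : Continuous fun t : ℝ => y + t • (p - x) := by fun_prop
      simpa using (this.tendsto 0).mono_left nhdsWithin_le_nhds
    obtain ⟨t, htK, ht⟩ :=
      ((hcont.eventually (mem_interior_iff_mem_nhds.1 hy)).and self_mem_nhdsWithin).exists
    have hle := hnonpos _ htK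
    rw [map_add, map_smul, map_sub, smul_eq_mul] at hle
    have := mul_pos (mem_Ioi.1 ht) (sub_pos.2 (hf x hx))
    linarith
  · rw [hrep]
    have hcont : Filter.Tendsto (fun t : ℝ => f (t • x)) (nhdsWithin 0 (Ioi 0)) (nhds 0) := by
      have : Continuous fun t : ℝ => f (t • x) := by fun_prop
      simpa using (this.tendsto 0).mono_left nhdsWithin_le_nhds
    have : 0 ≤ f p := le_of_tendsto hcont <| by
      filter_upwards [self_mem_nhdsWithin] with t ht
      exact (hf _ (hK.smul_mem_interior ht hx)).le
    linarith

end IsProperCone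

theorem stmt_12 {n : ℕ} (K : Set (Fin n → ℝ)) (hK : IsProperCone K)
    (X : Matrix (Fin n) (Fin n) ℝ)
    (h : ∀ T S : Matrix (Fin n) (Fin n) ℝ,
      (∀ x ∈ posOrth n, T.mulVec x ∈ K) →
      (∀ x ∈ interior (posOrth n), T.mulVec x ∈ interior K) →
      (∀ x ∈ K, S.mulVec x ∈ posOrth n) →
      (∀ x ∈ interior K, S.mulVec x ∈ interior (posOrth n)) →
      (∀ i j, 0 ≤ (S * X * T) i j) ∧ (∀ i, ∃ j, 0 < (S * X * T) i j)) :
    ∀ x ∈ interior K, X.mulVec x ∈ interior K := by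
  intro x hx
  rcases isEmpty_or_nonempty (Fin n) with hn | hn
  · rwa [Subsingleton.elim (X.mulVec x) x]
  by_contra hp
  obtain ⟨s, hsK, hsint, hsp⟩ := hK.exists_dual_of_notMem_interior hp
  have hT : ∀ y, (Matrix.of fun i (_ : Fin n) => x i).mulVec y = (∑ j, y j) • x := by
    intro y
    ext i
    simp [mulVec, dotProduct, Finset.mul_sum, mul_comm]
  have hS : ∀ y i, (Matrix.of fun (_ : Fin n) j => s j).mulVec y i = s ⬝ᵥ y := fun _ _ => rfl
  obtain ⟨j, hj⟩ := (h (Matrix.of fun i _ => x i) (Matrix.of fun _ j => s j)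
    (fun y hy => by
      rw [hT]
      exact hK.2.1 _ (Finset.sum_nonneg fun i _ => hy i) x (interior_subset hx))
    (fun y hy => by
      rw [hT]
      exact hK.smul_mem_interior
        (Finset.sum_pos (fun i _ => mem_interior_posOrth.1 hy i) Finset.univ_nonempty) hx)
    (fun y hy i => hsK y hy)
    (fun y hy => mem_interior_posOrth.2 fun i => hsint y hy)).2 (Classical.arbitrary _)
  rw [Matrix.mul_assoc] at hj
  exact hj.not_ge hsp
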